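/- Let q > 1 be a real number, α₁ = ⌈q⌉ − 1, and let ℓ : J_q → J_q be the map ℓ(x) = α₁/(q−1) − x. Then: (i) ℓ(U_q) = U_q and ℓ(V_q) = V_q (the sets U_q and V_q are symmetric); and (ii) V_q is a closed subset of ℝ. -/

import Mathlib

open Classical

noncomputable section

/-- The largest digit in base `q`: `α₁ = ⌈q⌉ - 1`. -/
def alphaOne (q : ℝ) : ℕ := (⌈q⌉ - 1).toNat

/-- `c` (0-indexed: `c i` is the digit `c_{i+1}` of the paper) is an expansion of `x`
in base `q`: all digits lie in `{0, …, α₁}` and `x = ∑_{i≥1} c_i q^{-i}`. -/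
def IsExpansionOf (q x : ℝ) (c : ℕ → ℕ) : Prop :=
  (∀ i, c i ≤ alphaOne q) ∧ x = ∑' i, (c i : ℝ) / q ^ (i + 1)

/-- A sequence is called infinite if it has infinitely many nonzero terms. -/
def InfiniteSeq (c : ℕ → ℕ) : Prop := {i | c i ≠ 0}.Infinite

/-- Strict lexicographic order on sequences. -/
def LexLt (a b : ℕ → ℕ) : Prop := ∃ n, (∀ i, i < n → a i = b i) ∧ a n < b n

/-- Lexicographic order `≤` on sequences. -/
def LexLe (a b : ℕ → ℕ) : Prop := LexLt a b ∨ a = b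

/-- `b` is the greedy (lexicographically largest) expansion of `x` in base `q`. -/
def IsGreedyOf (q x : ℝ) (b : ℕ → ℕ) : Prop :=
  IsExpansionOf q x b ∧ ∀ c, IsExpansionOf q x c → LexLe c b

/-- `a` is the quasi-greedy (lexicographically largest infinite) expansion of `x`
in base `q`. -/
def IsQuasiGreedyOf (q x : ℝ) (a : ℕ → ℕ) : Prop :=
  IsExpansionOf q x a ∧ InfiniteSeq a ∧
    ∀ c, IsExpansionOf q x c → InfiniteSeq c → LexLe c a

/-- The quasi-greedy expansion of `x` in base `q`; by convention it is the zero
sequence whenever no infinite expansion exists (in particular for `x = 0`). -/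
def quasiGreedy (q x : ℝ) : ℕ → ℕ :=
  if h : ∃ a, IsQuasiGreedyOf q x a then h.choose else fun _ => 0

/-- The greedy expansion of `x` in base `q` (zero sequence if `x` has no expansion). -/
def greedy (q x : ℝ) : ℕ → ℕ :=
  if h : ∃ b, IsGreedyOf q x b then h.choose else fun _ => 0

/-- The interval `J_q = [0, α₁/(q-1)]`. -/
def Jq (q : ℝ) : Set ℝ := Set.Icc 0 ((alphaOne q : ℝ) / (q - 1))

/-- `U_q`: the set of real numbers having exactly one expansion in base `q`. -/
def Uq (q : ℝ) : Set ℝ := {x | ∃! c, IsExpansionOf q x c}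

/-- `U_q'`: the set of univoque sequences in base `q`. -/
def UqSeq (q : ℝ) : Set (ℕ → ℕ) := {c | ∃ x ∈ Uq q, IsExpansionOf q x c}

/-- `U`: the set of univoque numbers. -/
def USet : Set ℝ := {q | 1 < q ∧ ∃! c, IsExpansionOf q 1 c}

/-- `V_q`: the set of `x ∈ J_q` such that for every `n ≥ 1` with `a_n(x) > 0` the
conjugated shifted quasi-greedy expansion is lexicographically at most `(α_i)`. -/
def Vq (q : ℝ) : Set ℝ :=
  {x | x ∈ Jq q ∧ ∀ n, 0 < quasiGreedy q x n →
    LexLe (fun i => alphaOne q - quasiGreedy q x (n + 1 + i)) (quasiGreedy q 1)}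

/-- `V`: the set of `q > 1` whose quasi-greedy expansion `(α_i)` of `1` satisfies
`(α₁ - α_{k+i})_{i≥1} ≤ (α_i)_{i≥1}` lexicographically for all `k ≥ 1`. -/
def VSet : Set ℝ :=
  {q | 1 < q ∧ ∀ k, LexLe (fun i => alphaOne q - quasiGreedy q 1 (k + 1 + i)) (quasiGreedy q 1)}

/-! ### The lexicographic order -/

theorem lexLt_trichotomy (a b : ℕ → ℕ) : LexLt a b ∨ a = b ∨ LexLt b a := by
  by_cases h : a = b
  · exact Or.inr (Or.inl h)
  · have hex : ∃ n, a n ≠ b n := Function.ne_iff.mp h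
    have hmin : ∀ i, i < Nat.find hex → a i = b i := fun i hi => not_not.mp (Nat.find_min hex hi)
    rcases lt_or_gt_of_ne (Nat.find_spec hex) with h1 | h1
    · exact Or.inl ⟨_, hmin, h1⟩
    · exact Or.inr (Or.inr ⟨_, fun i hi => (hmin i hi).symm, h1⟩)

theorem LexLt.not_lexLe {a b : ℕ → ℕ} (h : LexLt a b) : ¬ LexLe b a := by
  obtain ⟨n, hn, hlt⟩ := h
  rintro (⟨m, hm, hlt'⟩ | rfl)
  · rcases lt_trichotomy n m with h | rfl | h
    · exact hlt.ne (hm n h).symm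
    · exact lt_asymm hlt hlt'
    · exact hlt'.ne (hn m h).symm
  · exact lt_irrefl _ hlt

theorem not_lexLe {a b : ℕ → ℕ} : ¬ LexLe a b ↔ LexLt b a := by
  refine ⟨fun h => ?_, LexLt.not_lexLe⟩
  rcases lexLt_trichotomy a b with h1 | h1 | h1
  · exact absurd (Or.inl h1) h
  · exact absurd (Or.inr h1) h
  · exact h1

theorem LexLe.antisymm {a b : ℕ → ℕ} (hab : LexLe a b) (hba : LexLe b a) : a = b :=
  hab.elim (fun h => absurd hba h.not_lexLe) id

theorem lexLe_const {a : ℕ → ℕ} {m : ℕ} (h : ∀ i, a i ≤ m) : LexLe a (fun _ => m) := by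
  by_contra hlt
  obtain ⟨n, -, hn⟩ := not_lexLe.mp hlt
  exact absurd (h n) (not_le.mpr hn)

theorem isClosed_setOf_lexLe (b : ℕ → ℕ) : IsClosed {a : ℕ → ℕ | LexLe a b} := by
  rw [← isOpen_compl_iff]
  have : {a : ℕ → ℕ | LexLe a b}ᶜ =
      ⋃ n, (⋂ i ∈ Set.Iio n, {a : ℕ → ℕ | b i = a i}) ∩ {a : ℕ → ℕ | b n < a n} := by
    ext a
    simp [not_lexLe, LexLt]
  rw [this]
  refine isOpen_iUnion fun n => IsOpen.inter ?_ ?_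
  · exact (Set.finite_Iio n).isOpen_biInter fun i _ =>
      (isOpen_discrete {k : ℕ | b i = k}).preimage (continuous_apply i)
  · exact (isOpen_discrete {k : ℕ | b n < k}).preimage (continuous_apply n)

/-! ### Values of digit sequences -/

/-- The number represented in base `q` by the digit sequence `c`. -/
def baseValue (q : ℝ) (c : ℕ → ℕ) : ℝ := ∑' i, (c i : ℝ) / q ^ (i + 1)

theorem alphaOne_cast {q : ℝ} (hq : 1 < q) : (alphaOne q : ℝ) = ⌈q⌉ - 1 := by
  have h : 1 < ⌈q⌉ := Int.lt_ceil.mpr (by exact_mod_cast hq)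
  have : ((alphaOne q : ℕ) : ℤ) = ⌈q⌉ - 1 := Int.toNat_of_nonneg (by lia)
  exact_mod_cast congrArg (Int.cast : ℤ → ℝ) this

theorem one_le_alphaOne_div {q : ℝ} (hq : 1 < q) : 1 ≤ (alphaOne q : ℝ) / (q - 1) := by
  rw [one_le_div (by linarith), alphaOne_cast hq]
  linarith [Int.le_ceil q]

theorem hasSum_const_div_pow {q : ℝ} (hq : 1 < q) (m : ℝ) :
    HasSum (fun i : ℕ => m / q ^ (i + 1)) (m / (q - 1)) := by
  have h := (hasSum_geometric_of_lt_one (r := q⁻¹) (by positivity)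
    (inv_lt_one_of_one_lt₀ hq)).mul_left (m / q)
  have h1 : q - 1 ≠ 0 := by linarith
  have h0 : q ≠ 0 := by linarith
  have hterm : (fun i : ℕ => m / q ^ (i + 1)) = fun i => m / q * q⁻¹ ^ i := by
    ext i
    rw [pow_succ, inv_pow]
    field_simp
  have hval : m / (q - 1) = m / q * (1 - q⁻¹)⁻¹ := by field_simp
  rw [hterm, hval]
  exact h

theorem summable_digits {q : ℝ} (hq : 1 < q) {m : ℕ} {c : ℕ → ℕ} (hc : ∀ i, c i ≤ m) :
    Summable fun i => (c i : ℝ) / q ^ (i + 1) := by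
  refine Summable.of_nonneg_of_le (fun i => by positivity) (fun i => ?_)
    (hasSum_const_div_pow hq m).summable
  have : (c i : ℝ) ≤ m := by exact_mod_cast hc i
  gcongr

theorem baseValue_nonneg {q : ℝ} (hq : 1 < q) (c : ℕ → ℕ) : 0 ≤ baseValue q c :=
  tsum_nonneg fun i => by positivity

theorem baseValue_le {q : ℝ} (hq : 1 < q) {m : ℕ} {c : ℕ → ℕ} (hc : ∀ i, c i ≤ m) :
    baseValue q c ≤ m / (q - 1) := by
  rw [← (hasSum_const_div_pow hq m).tsum_eq]
  refine (summable_digits hq hc).tsum_le_tsum (fun i => ?_) (hasSum_const_div_pow hq m).summable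
  have : (c i : ℝ) ≤ m := by exact_mod_cast hc i
  gcongr

theorem baseValue_pos {q : ℝ} (hq : 1 < q) {m : ℕ} {c : ℕ → ℕ} (hc : ∀ i, c i ≤ m) {n : ℕ}
    (hn : c n ≠ 0) : 0 < baseValue q c :=
  (summable_digits hq hc).tsum_pos (fun i => by positivity) n (by positivity)

theorem baseValue_conj {q : ℝ} (hq : 1 < q) {m : ℕ} {c : ℕ → ℕ} (hc : ∀ i, c i ≤ m) :
    baseValue q (fun i => m - c i) = m / (q - 1) - baseValue q c := by
  have h := (hasSum_const_div_pow hq m).sub (summable_digits hq hc).hasSum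
  rw [baseValue, baseValue, ← h.tsum_eq]
  refine tsum_congr fun i => ?_
  rw [Nat.cast_sub (hc i), sub_div]

theorem baseValue_succ {q : ℝ} (hq : 1 < q) {m : ℕ} {c : ℕ → ℕ} (hc : ∀ i, c i ≤ m) :
    baseValue q c = (c 0 + baseValue q (fun i => c (i + 1))) / q := by
  rw [baseValue, (summable_digits hq hc).tsum_eq_zero_add, baseValue, add_div, ← tsum_div_const]
  congr 1
  · simp
  · refine tsum_congr fun i => ?_
    rw [pow_succ q (i + 1), div_div]

theorem baseValue_sub_of_eq {q : ℝ} (hq : 1 < q) {m : ℕ} {c d : ℕ → ℕ} (hc : ∀ i, c i ≤ m)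
    (hd : ∀ i, d i ≤ m) {n : ℕ} (h : ∀ i, i < n → c i = d i) :
    baseValue q c - baseValue q d = ((c n : ℝ) - d n + baseValue q (fun i => c (n + 1 + i)) -
      baseValue q (fun i => d (n + 1 + i))) / q ^ (n + 1) := by
  induction n generalizing c d with
  | zero =>
    rw [baseValue_succ hq hc, baseValue_succ hq hd]
    simp only [zero_add, add_comm 1]
    ring
  | succ n ih =>
    rw [baseValue_succ hq hc, baseValue_succ hq hd, h 0 n.succ_pos, ← sub_div,
      add_sub_add_left_eq_sub, ih (fun i => hc (i + 1)) (fun i => hd (i + 1))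
      (fun i hi => h (i + 1) (by lia)), div_div, ← pow_succ]
    simp only [add_right_comm _ _ 1]

theorem baseValue_eq_of_recursion {q : ℝ} (hq : 1 < q) {m : ℕ} {c : ℕ → ℕ} (hc : ∀ i, c i ≤ m)
    {r : ℕ → ℝ} {C : ℝ} (hr : ∀ n, |r n| ≤ C) (hrec : ∀ n, r (n + 1) = q * r n - c n) :
    baseValue q c = r 0 := by
  have hq0 : 0 < q := by linarith
  have hpart : ∀ n, ∑ i ∈ Finset.range n, (c i : ℝ) / q ^ (i + 1) = r 0 - r n * (q⁻¹) ^ n := by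
    intro n
    induction n with
    | zero => simp
    | succ n ih =>
      rw [Finset.sum_range_succ, ih, hrec, inv_pow, inv_pow, pow_succ]
      field_simp
      ring
  have hpow : Filter.Tendsto (fun n : ℕ => (q⁻¹) ^ n) Filter.atTop (nhds 0) :=
    tendsto_pow_atTop_nhds_zero_of_lt_one (by positivity) (inv_lt_one_of_one_lt₀ hq)
  have hlim : Filter.Tendsto (fun n => r n * (q⁻¹) ^ n) Filter.atTop (nhds 0) := by
    refine squeeze_zero_norm (a := fun n => C * (q⁻¹) ^ n) (fun n => ?_)
      (by simpa using hpow.const_mul C)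
    rw [norm_mul, Real.norm_eq_abs, norm_pow, Real.norm_of_nonneg (inv_nonneg.mpr hq0.le)]
    exact mul_le_mul_of_nonneg_right (hr n) (by positivity)
  refine tendsto_nhds_unique (summable_digits hq hc).hasSum.tendsto_sum_nat ?_
  simp only [hpart]
  simpa using hlim.const_sub (r 0)

theorem continuousOn_baseValue {q : ℝ} (hq : 1 < q) (m : ℕ) :
    ContinuousOn (baseValue q) {c | ∀ i, c i ≤ m} := by
  refine continuousOn_tsum (u := fun i => (m : ℝ) / q ^ (i + 1)) (fun i => ?_)
    (hasSum_const_div_pow hq m).summable (fun i c hc => ?_)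
  · exact (((continuous_of_discreteTopology (f := fun k : ℕ => (k : ℝ))).comp
      (continuous_apply i)).div_const _).continuousOn
  · have : (c i : ℝ) ≤ m := by exact_mod_cast hc i
    rw [Real.norm_of_nonneg (by positivity)]
    gcongr

/-! ### Quasi-greedy expansions -/

/-- A tail following a non-maximal digit represents a number at most `1`. -/
def TailsLeOne (q : ℝ) (c : ℕ → ℕ) : Prop :=
  ∀ n, c n < alphaOne q → baseValue q (fun i => c (n + 1 + i)) ≤ 1

theorem InfiniteSeq.shift {c : ℕ → ℕ} (h : InfiniteSeq c) (k : ℕ) :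
    InfiniteSeq (fun i => c (k + i)) := by
  refine Set.infinite_of_forall_exists_gt fun n => ?_
  obtain ⟨j, hj, hlt⟩ := h.exists_gt (k + n)
  exact ⟨j - k, by simpa [Nat.add_sub_of_le (by lia : k ≤ j)] using hj, by lia⟩

theorem InfiniteSeq.exists_ne_zero {c : ℕ → ℕ} (h : InfiniteSeq c) : ∃ n, c n ≠ 0 :=
  h.nonempty

/-- Sequences with `TailsLeOne` are lexicographically monotone in the number they represent. -/
theorem TailsLeOne.lexLe {q : ℝ} (hq : 1 < q) {a c : ℕ → ℕ} (ha : ∀ i, a i ≤ alphaOne q)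
    (hta : TailsLeOne q a) (hc : ∀ i, c i ≤ alphaOne q) (hinf : InfiniteSeq c)
    (hle : baseValue q c ≤ baseValue q a) : LexLe c a := by
  by_contra hlt
  obtain ⟨n, hn, hlt⟩ := not_lexLe.mp hlt
  have h1 := hta n (hlt.trans_le (hc n))
  obtain ⟨k, hk⟩ := (hinf.shift (n + 1)).exists_ne_zero
  have h2 := baseValue_pos hq (fun i => hc (n + 1 + i)) hk
  have h3 := baseValue_sub_of_eq hq hc ha (fun i hi => (hn i hi).symm)
  have h4 : (a n : ℝ) + 1 ≤ c n := by exact_mod_cast hlt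
  have h5 : 0 < baseValue q c - baseValue q a := by
    rw [h3]
    exact div_pos (by linarith) (pow_pos (by linarith) _)
  linarith

theorem TailsLeOne.isQuasiGreedyOf {q : ℝ} (hq : 1 < q) {a : ℕ → ℕ} (ha : ∀ i, a i ≤ alphaOne q)
    (hta : TailsLeOne q a) (hinf : InfiniteSeq a) : IsQuasiGreedyOf q (baseValue q a) a :=
  ⟨⟨ha, rfl⟩, hinf, fun _ hc hcinf => hta.lexLe hq ha hc.1 hcinf hc.2.ge⟩

/-- The quasi-greedy algorithm. -/
theorem exists_tailsLeOne {q x : ℝ} (hq : 1 < q) (hx : 0 < x)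
    (hxle : x ≤ (alphaOne q : ℝ) / (q - 1)) :
    ∃ a, (∀ i, a i ≤ alphaOne q) ∧ baseValue q a = x ∧ InfiniteSeq a ∧ TailsLeOne q a := by
  set m := alphaOne q with hm
  let digit : ℝ → ℕ := fun r => min m (⌈q * r⌉₊ - 1)
  let r : ℕ → ℝ := fun n => (fun s => q * s - digit s)^[n] x
  have hrec : ∀ n, r (n + 1) = q * r n - digit (r n) := fun n => Function.iterate_succ_apply' _ _ _
  have hT := one_le_alphaOne_div hq
  have hq1 : 0 < q - 1 := by linarith
  have hstep : ∀ s, 0 < s → s ≤ (m : ℝ) / (q - 1) → 0 < q * s - digit s ∧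
      q * s - digit s ≤ (m : ℝ) / (q - 1) ∧ (digit s < m → q * s - digit s ≤ 1) := by
    intro s hs hsle
    have hqs : 0 < q * s := by positivity
    have hceil : 0 < ⌈q * s⌉₊ := Nat.ceil_pos.mpr hqs
    have hcast : ((⌈q * s⌉₊ - 1 : ℕ) : ℝ) = (⌈q * s⌉₊ : ℝ) - 1 := by
      rw [Nat.cast_sub hceil, Nat.cast_one]
    have h1 := Nat.ceil_lt_add_one hqs.le
    have h2 := Nat.le_ceil (q * s)
    rcases le_or_gt m (⌈q * s⌉₊ - 1) with h | h
    · have hd : digit s = m := min_eq_left h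
      have h' : (m : ℝ) ≤ (⌈q * s⌉₊ : ℝ) - 1 := by rw [← hcast]; exact_mod_cast h
      refine ⟨by rw [hd]; linarith, ?_, fun hlt => absurd hlt (by simp [hd])⟩
      rw [hd]
      rw [le_div_iff₀ hq1] at hsle ⊢
      nlinarith
    · have hd : digit s = ⌈q * s⌉₊ - 1 := min_eq_right h.le
      rw [hd, hcast]
      exact ⟨by linarith, by linarith, fun _ => by linarith⟩
  have hr : ∀ n, 0 < r n ∧ r n ≤ (m : ℝ) / (q - 1) := by
    intro n
    induction n with
    | zero => exact ⟨hx, hxle⟩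
    | succ n ih =>
      rw [hrec]
      exact ⟨(hstep _ ih.1 ih.2).1, (hstep _ ih.1 ih.2).2.1⟩
  have ha : ∀ i, digit (r i) ≤ m := fun i => min_le_left _ _
  have hval : ∀ n, baseValue q (fun i => digit (r (n + i))) = r n := fun n =>
    baseValue_eq_of_recursion hq (r := fun i => r (n + i)) (fun i => ha (n + i))
      (fun i => by rw [abs_of_pos (hr _).1]; exact (hr _).2) (fun i => hrec (n + i))
  refine ⟨fun i => digit (r i), ha, ?_, ?_, ?_⟩
  · have h := hval 0
    simp only [zero_add] at h
    exact h
  · refine Set.infinite_of_forall_exists_gt fun n => ?_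
    by_contra! hcon
    have hz : (fun i => digit (r (n + 1 + i))) = fun _ => 0 := by
      ext i
      by_contra hne
      exact absurd (hcon (n + 1 + i) hne) (by lia)
    have h := hval (n + 1)
    rw [hz] at h
    have h' := (hr (n + 1)).1
    rw [← h] at h'
    simp [baseValue] at h'
  · intro n hn
    rw [hval, hrec]
    exact (hstep _ (hr n).1 (hr n).2).2.2 hn

theorem IsQuasiGreedyOf.quasiGreedy_eq {q x : ℝ} {a : ℕ → ℕ} (h : IsQuasiGreedyOf q x a) :
    quasiGreedy q x = a := by
  have hex : ∃ a, IsQuasiGreedyOf q x a := ⟨a, h⟩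
  rw [quasiGreedy, dif_pos hex]
  have h' := hex.choose_spec
  exact (h.2.2 _ h'.1 h'.2.1).antisymm (h'.2.2 _ h.1 h.2.1)

theorem quasiGreedy_spec {q x : ℝ} (hq : 1 < q) (hx : 0 < x)
    (hxle : x ≤ (alphaOne q : ℝ) / (q - 1)) :
    (∀ i, quasiGreedy q x i ≤ alphaOne q) ∧ baseValue q (quasiGreedy q x) = x ∧
      InfiniteSeq (quasiGreedy q x) ∧ TailsLeOne q (quasiGreedy q x) := by
  obtain ⟨a, ha, hval, hinf, hta⟩ := exists_tailsLeOne hq hx hxle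
  have h := (hta.isQuasiGreedyOf hq ha hinf).quasiGreedy_eq
  rw [hval] at h
  rw [h]
  exact ⟨ha, hval, hinf, hta⟩

theorem quasiGreedy_zero {q : ℝ} (hq : 1 < q) : quasiGreedy q 0 = fun _ => 0 := by
  refine dif_neg ?_
  rintro ⟨a, ha, hinf, -⟩
  obtain ⟨n, hn⟩ := hinf.exists_ne_zero
  exact (baseValue_pos hq ha.1 hn).ne ha.2

theorem quasiGreedy_one_spec {q : ℝ} (hq : 1 < q) :
    (∀ i, quasiGreedy q 1 i ≤ alphaOne q) ∧ baseValue q (quasiGreedy q 1) = 1 ∧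
      InfiniteSeq (quasiGreedy q 1) ∧ TailsLeOne q (quasiGreedy q 1) :=
  quasiGreedy_spec hq one_pos (one_le_alphaOne_div hq)

theorem TailsLeOne.shift_lexLe {q : ℝ} (hq : 1 < q) {a : ℕ → ℕ} (ha : ∀ i, a i ≤ alphaOne q)
    (hta : TailsLeOne q a) (hinf : InfiniteSeq a) {n : ℕ} (hn : a n < alphaOne q) :
    LexLe (fun i => a (n + 1 + i)) (quasiGreedy q 1) := by
  obtain ⟨hα, hval, -, htα⟩ := quasiGreedy_one_spec hq
  exact htα.lexLe hq hα (fun i => ha _) (hinf.shift _) (by rw [hval]; exact hta n hn)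

theorem tailsLeOne_of_shift_lexLe {q : ℝ} (hq : 1 < q) {c : ℕ → ℕ} (hc : ∀ i, c i ≤ alphaOne q)
    (h : ∀ n, c n < alphaOne q → LexLe (fun i => c (n + 1 + i)) (quasiGreedy q 1)) :
    TailsLeOne q c := by
  obtain ⟨hα, hval, -, -⟩ := quasiGreedy_one_spec hq
  have hq0 : 0 < q := by linarith
  set T := (alphaOne q : ℝ) / (q - 1) with hT
  have hT0 : 0 ≤ T := zero_le_one.trans (one_le_alphaOne_div hq)
  have hbound : ∀ k n, c n < alphaOne q →
      baseValue q (fun i => c (n + 1 + i)) - 1 ≤ T * (q⁻¹) ^ k := by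
    intro k
    induction k with
    | zero =>
      intro n _
      have := baseValue_le hq fun i => hc (n + 1 + i)
      rw [pow_zero, mul_one]
      linarith
    | succ k ih =>
      intro n hn
      rcases h n hn with ⟨j, hj, hlt⟩ | heq
      · have h1 := baseValue_sub_of_eq hq (fun i => hc (n + 1 + i)) hα hj
        have h2 := ih (n + 1 + j) (hlt.trans_le (hα j))
        have h3 := baseValue_nonneg hq fun i => quasiGreedy q 1 (j + 1 + i)
        have h4 : (c (n + 1 + j) : ℝ) + 1 ≤ quasiGreedy q 1 j := by exact_mod_cast hlt
        have h5 : q ≤ q ^ (j + 1) := le_self_pow₀ hq.le (by lia)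
        simp only [add_assoc] at h1 h2 h3 h4 ⊢
        rw [← hval, h1, pow_succ q⁻¹, ← mul_assoc, ← div_eq_mul_inv]
        have h6 : 0 ≤ T * (q⁻¹) ^ k := by positivity
        calc _ ≤ T * (q⁻¹) ^ k / q ^ (j + 1) := by gcongr; linarith
          _ ≤ _ := by gcongr
      · rw [heq, hval, sub_self]
        positivity
  intro n hn
  have hpow : Filter.Tendsto (fun k : ℕ => T * (q⁻¹) ^ k) Filter.atTop (nhds 0) := by
    simpa using (tendsto_pow_atTop_nhds_zero_of_lt_one (by positivity)
      (inv_lt_one_of_one_lt₀ hq)).const_mul T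
  linarith [ge_of_tendsto' hpow fun k => hbound k n hn]

/-! ### The sequences describing `V_q` -/

/-- Digit sequences all of whose tails obey the lexicographic bound defining `V_q`, together
with its conjugate. -/
def VqSeq (q : ℝ) : Set (ℕ → ℕ) :=
  {c | (∀ i, c i ≤ alphaOne q) ∧
    (∀ n, c n < alphaOne q → LexLe (fun i => c (n + 1 + i)) (quasiGreedy q 1)) ∧
    ∀ n, 0 < c n → LexLe (fun i => alphaOne q - c (n + 1 + i)) (quasiGreedy q 1)}

theorem conj_mem_VqSeq {q : ℝ} {c : ℕ → ℕ} (hc : c ∈ VqSeq q) :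
    (fun i => alphaOne q - c i) ∈ VqSeq q := by
  obtain ⟨hd, h1, h2⟩ := hc
  refine ⟨fun i => Nat.sub_le _ _, fun n hn => h2 n (by lia), fun n hn => ?_⟩
  simp only [Nat.sub_sub_self (hd _)]
  exact h1 n (by lia)

theorem isCompact_VqSeq (q : ℝ) : IsCompact (VqSeq q) := by
  have hK : IsCompact {c : ℕ → ℕ | ∀ i, c i ≤ alphaOne q} := by
    have := isCompact_univ_pi fun _ : ℕ => (Set.finite_Iic (alphaOne q)).isCompact
    simpa [Set.pi] using this
  have hcl : ∀ (p : ℕ → Prop) (g : ℕ → ℕ) (n : ℕ),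
      IsClosed {c : ℕ → ℕ | p (c n) → LexLe (fun i => g (c (n + 1 + i))) (quasiGreedy q 1)} := by
    intro p g n
    refine isClosed_imp ((isOpen_discrete {k | p k}).preimage (continuous_apply n))
      ((isClosed_setOf_lexLe _).preimage (continuous_pi fun i => ?_))
    exact continuous_of_discreteTopology.comp (continuous_apply (n + 1 + i))
  have : VqSeq q = {c : ℕ → ℕ | ∀ i, c i ≤ alphaOne q} ∩
      ((⋂ n, {c : ℕ → ℕ | c n < alphaOne q → LexLe (fun i => c (n + 1 + i)) (quasiGreedy q 1)}) ∩
      ⋂ n, {c : ℕ → ℕ | 0 < c n →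
        LexLe (fun i => alphaOne q - c (n + 1 + i)) (quasiGreedy q 1)}) := by
    ext c
    simp [VqSeq]
  rw [this]
  exact hK.inter_right ((isClosed_iInter fun n => hcl (· < alphaOne q) id n).inter
    (isClosed_iInter fun n => hcl (0 < ·) (alphaOne q - ·) n))

theorem quasiGreedy_one_eq_const {q : ℝ} (hq : 1 < q) {c : ℕ → ℕ} (hc : c ∈ VqSeq q)
    (hfin : ¬ InfiniteSeq c) {n : ℕ} (hn : c n ≠ 0) :
    quasiGreedy q 1 = fun _ => alphaOne q := by
  have hfin' : {i | c i ≠ 0}.Finite := Set.not_infinite.mp hfin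
  obtain ⟨N, hN, hmax⟩ := hfin'.exists_maximal ⟨n, hn⟩
  have hz : ∀ i, c (N + 1 + i) = 0 := by
    intro i
    by_contra hne
    have : N + 1 + i ≤ N := hmax hne (by lia)
    lia
  have h := hc.2.2 N (Nat.pos_of_ne_zero hN)
  simp only [hz, Nat.sub_zero] at h
  exact (lexLe_const (quasiGreedy_one_spec hq).1).antisymm h

theorem image_VqSeq {q : ℝ} (hq : 1 < q) : baseValue q '' VqSeq q = Vq q := by
  ext x
  constructor
  · rintro ⟨c, hc, rfl⟩
    refine ⟨⟨baseValue_nonneg hq c, baseValue_le hq hc.1⟩, ?_⟩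
    by_cases hinf : InfiniteSeq c
    · rw [((tailsLeOne_of_shift_lexLe hq hc.1 hc.2.1).isQuasiGreedyOf hq hc.1 hinf).quasiGreedy_eq]
      exact hc.2.2
    · by_cases hzero : ∃ n, c n ≠ 0
      · obtain ⟨n, hn⟩ := hzero
        intro k _
        rw [quasiGreedy_one_eq_const hq hc hinf hn]
        exact lexLe_const fun i => Nat.sub_le _ _
      · push Not at hzero
        have : baseValue q c = 0 := by simp [baseValue, hzero]
        simp [this, quasiGreedy_zero hq]
  · rintro ⟨⟨hx0, hxle⟩, hx⟩
    rcases hx0.eq_or_lt with rfl | hpos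
    · refine ⟨fun _ => 0, ⟨fun i => Nat.zero_le _, fun n _ => ?_, fun n hn => ?_⟩, ?_⟩
      · by_contra hlt
        obtain ⟨k, -, hk⟩ := not_lexLe.mp hlt
        exact Nat.not_lt_zero _ hk
      · exact absurd hn (lt_irrefl _)
      · simp [baseValue]
    · obtain ⟨ha, hval, hinf, hta⟩ := quasiGreedy_spec hq hpos hxle
      exact ⟨_, ⟨ha, fun n hn => hta.shift_lexLe hq ha hinf hn, hx⟩, hval⟩

theorem IsExpansionOf.conj {q x : ℝ} (hq : 1 < q) {c : ℕ → ℕ} (hc : IsExpansionOf q x c) :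
    IsExpansionOf q ((alphaOne q : ℝ) / (q - 1) - x) (fun i => alphaOne q - c i) :=
  ⟨fun i => Nat.sub_le _ _, by
    rw [hc.2]
    exact (baseValue_conj hq hc.1).symm⟩

/-- A set mapped into itself by a reflection is equal to its image. -/
theorem image_const_sub_eq_self {t : ℝ} {S : Set ℝ} (h : ∀ x ∈ S, t - x ∈ S) :
    (fun x => t - x) '' S = S := by
  refine Set.Subset.antisymm (Set.image_subset_iff.mpr h) fun x hx => ⟨t - x, h x hx, ?_⟩
  exact sub_sub_cancel t x

theorem sub_mem_Uq {q x : ℝ} (hq : 1 < q) (hx : x ∈ Uq q) :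
    (alphaOne q : ℝ) / (q - 1) - x ∈ Uq q := by
  obtain ⟨c, hc, huniq⟩ := hx
  refine ⟨_, hc.conj hq, fun d hd => ?_⟩
  have h := hd.conj hq
  rw [sub_sub_cancel] at h
  rw [← huniq _ h]
  ext i
  exact (Nat.sub_sub_self (hd.1 i)).symm

theorem sub_mem_Vq {q x : ℝ} (hq : 1 < q) (hx : x ∈ Vq q) :
    (alphaOne q : ℝ) / (q - 1) - x ∈ Vq q := by
  rw [← image_VqSeq hq] at hx ⊢
  obtain ⟨c, hc, rfl⟩ := hx
  exact ⟨_, conj_mem_VqSeq hc, baseValue_conj hq hc.1⟩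

/-- The sets `U_q` and `V_q` are symmetric under
`ℓ(x) = α₁/(q-1) - x`, and `V_q` is closed. -/
theorem Uq_Vq_symmetric_and_Vq_closed (q : ℝ) (hq : 1 < q) :
    (fun x : ℝ => (alphaOne q : ℝ) / (q - 1) - x) '' Uq q = Uq q ∧
    (fun x : ℝ => (alphaOne q : ℝ) / (q - 1) - x) '' Vq q = Vq q ∧
    IsClosed (Vq q) := by
  refine ⟨image_const_sub_eq_self fun x => sub_mem_Uq hq,
    image_const_sub_eq_self fun x => sub_mem_Vq hq, ?_⟩
  rw [← image_VqSeq hq]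
  exact ((isCompact_VqSeq q).image_of_continuousOn
    ((continuousOn_baseValue hq _).mono fun c hc => hc.1)).isClosed
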